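/- Let h = (n,n,…,n) be the Hessenberg function with h(j) = n for all j. Then the ideal I(h) of ℚ[x_1,…,x_n,t], generated by f_{n,1}, f_{n,2}, …, f_{n,n}, is equal to the ideal generated by the n polynomials e_i(x_1,…,x_n) − e_i(1,2,…,n)·t^i for 1 ≤ i ≤ n, where e_i denotes the degree-i elementary symmetric polynomial. -/

import Mathlib

open MvPolynomial Finset

/-- The variable `t` in `ℚ[x_1,…,x_n,t]`, realized as `MvPolynomial (Option (Fin n)) ℚ`
with `t = X none`. -/
noncomputable def tv (n : ℕ) : MvPolynomial (Option (Fin n)) ℚ := X none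

/-- The variable `x_k` (for `1 ≤ k ≤ n`) in `ℚ[x_1,…,x_n,t]`. -/
noncomputable def xv (n : ℕ) (k : ℕ) : MvPolynomial (Option (Fin n)) ℚ :=
  if h : k - 1 < n then X (some ⟨k - 1, h⟩) else 0

/-- `p_i = ∑_{k=1}^i (x_k - k t)`, with `p_0 = 0`. -/
noncomputable def pp (n : ℕ) (i : ℕ) : MvPolynomial (Option (Fin n)) ℚ :=
  ∑ k ∈ Finset.range i, (xv n (k + 1) - C ((k : ℚ) + 1) * tv n)

/-- The polynomials `f_{i,j}`: `f_{i,0} = 0`, `f_{j,j} = p_j`, and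
`f_{i,j} = f_{i-1,j-1} + (x_j - x_i - t) f_{i-1,j}` for `i > j ≥ 1`. -/
noncomputable def ff (n : ℕ) : ℕ → ℕ → MvPolynomial (Option (Fin n)) ℚ
  | _, 0 => 0
  | 0, _ + 1 => 0
  | i + 1, j + 1 =>
      if i = j then pp n (j + 1)
      else ff n i j + (xv n (j + 1) - xv n (i + 1) - tv n) * ff n i (j + 1)


/-- The degree-`i` elementary symmetric polynomial `e_i(x_1,…,x_n)` in
`ℚ[x_1,…,x_n,t]`. -/
noncomputable def esymmX (n : ℕ) (i : ℕ) : MvPolynomial (Option (Fin n)) ℚ :=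
  ∑ A ∈ Finset.powersetCard i (Finset.univ : Finset (Fin n)), ∏ k ∈ A, X (some k)

/-- The rational number `e_i(1,2,…,n)`. -/
noncomputable def esymmVal (n : ℕ) (i : ℕ) : ℚ :=
  ∑ A ∈ Finset.powersetCard i (Finset.univ : Finset (Fin n)), ∏ k ∈ A, ((k : ℕ) + 1 : ℚ)


/-- Triangularity: if `T k` has degree at most `k` and unit `k`-th coefficient, the coefficients of
`∑ c k T k` lie in an ideal iff all `c k` do. -/
theorem aux_tri {R : Type*} [CommRing R] (K : Ideal R) (c : ℕ → R) (T : ℕ → Polynomial R) (n : ℕ)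
    (hdeg : ∀ k < n, ∀ m, k < m → (T k).coeff m = 0)
    (hu : ∀ k < n, IsUnit ((T k).coeff k)) :
    (∀ m, (∑ k ∈ range n, Polynomial.C (c k) * T k).coeff m ∈ K) ↔ ∀ k < n, c k ∈ K := by
  induction n with
  | zero => simp
  | succ n ih =>
    have ih' := ih (fun k hk => hdeg k (by omega)) (fun k hk => hu k (by omega))
    constructor
    · intro h
      have h1 : c n ∈ K := by
        have h2 := h n
        rw [sum_range_succ, Polynomial.coeff_add, Polynomial.coeff_C_mul,
          Polynomial.finsetSum_coeff, Finset.sum_eq_zero, zero_add] at h2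
        · exact (Ideal.mul_unit_mem_iff_mem K (hu n (by omega))).1 h2
        · intro k hk
          have hk' := mem_range.1 hk
          rw [Polynomial.coeff_C_mul, hdeg k (by omega) n hk', mul_zero]
      have h3 := ih'.1 (fun m => by
        have h2 := h m
        rw [sum_range_succ, Polynomial.coeff_add, Polynomial.coeff_C_mul] at h2
        exact (Ideal.add_mem_iff_left K (Ideal.mul_mem_right _ _ h1)).1 h2)
      intro k hk
      rcases Nat.lt_succ_iff_lt_or_eq.1 hk with h4 | h4
      · exact h3 k h4
      · exact h4 ▸ h1
    · intro h m
      rw [Polynomial.finsetSum_coeff]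
      refine Ideal.sum_mem _ fun k hk => ?_
      rw [Polynomial.coeff_C_mul]
      exact Ideal.mul_mem_right _ _ (h k (mem_range.1 hk))

/-- `∏_{k ≤ i} (z - x_k)` -/
noncomputable def auxP (n i : ℕ) : Polynomial (MvPolynomial (Option (Fin n)) ℚ) :=
  ∏ k ∈ range i, (Polynomial.X - Polynomial.C (xv n (k + 1)))

/-- `∏_{k ≤ i} (z - k t)` -/
noncomputable def auxQ (n i : ℕ) : Polynomial (MvPolynomial (Option (Fin n)) ℚ) :=
  ∏ k ∈ range i, (Polynomial.X - Polynomial.C (C ((k : ℚ) + 1) * tv n))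

noncomputable def auxF (n i : ℕ) : Polynomial (MvPolynomial (Option (Fin n)) ℚ) :=
  ∑ j ∈ range i, Polynomial.C (ff n i (j + 1)) * auxP n j

noncomputable def auxT (n k : ℕ) : Polynomial (MvPolynomial (Option (Fin n)) ℚ) :=
  ∑ i ∈ range k, Polynomial.X ^ i * (Polynomial.X - Polynomial.C (tv n)) ^ (k - i)
    - (n : Polynomial _) * Polynomial.X ^ k

theorem ff_above (n i j : ℕ) (h : i < j) : ff n i j = 0 := by
  induction i generalizing j with
  | zero =>
    cases j with
    | zero => omega
    | succ j => simp [ff]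
  | succ i ih =>
    cases j with
    | zero => omega
    | succ j =>
      rw [ff, if_neg (by omega), ih j (by omega), ih (j + 1) (by omega)]
      simp

theorem ff_diag (n i : ℕ) : ff n i i = pp n i := by
  cases i with
  | zero => simp [ff, pp]
  | succ i => simp [ff]

theorem auxF_succ (n i : ℕ) : auxF n (i + 1) =
    auxF n i * (Polynomial.X - Polynomial.C (xv n (i + 1)) - Polynomial.C (tv n))
      + Polynomial.C (xv n (i + 1) - C ((i : ℚ) + 1) * tv n) * auxP n i := by
  have hrec : ∀ j < i, ff n (i + 1) (j + 1) =
      ff n i j + (xv n (j + 1) - xv n (i + 1) - tv n) * ff n i (j + 1) := by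
    intro j hj
    rw [ff, if_neg (by omega)]
  have hd : ff n (i + 1) (i + 1) = ff n i i + (xv n (i + 1) - C ((i : ℚ) + 1) * tv n) := by
    rw [ff_diag, ff_diag, pp, pp, sum_range_succ]
  have h0 : ∑ j ∈ range i, Polynomial.C (ff n i j) * auxP n j + Polynomial.C (ff n i i) * auxP n i
      = ∑ j ∈ range i, Polynomial.C (ff n i (j + 1)) * auxP n (j + 1) := by
    rw [← sum_range_succ (fun j => Polynomial.C (ff n i j) * auxP n j), sum_range_succ']
    simp [ff]
  have h1 : ∑ j ∈ range i, Polynomial.C (ff n (i + 1) (j + 1)) * auxP n j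
      = ∑ j ∈ range i, Polynomial.C (ff n i j) * auxP n j
        + ∑ j ∈ range i, Polynomial.C ((xv n (j + 1) - xv n (i + 1) - tv n) * ff n i (j + 1))
          * auxP n j := by
    rw [← sum_add_distrib]
    refine sum_congr rfl fun j hj => ?_
    rw [hrec j (mem_range.1 hj), Polynomial.C_add]
    ring
  have h2 : auxF n i * (Polynomial.X - Polynomial.C (xv n (i + 1)) - Polynomial.C (tv n))
      = ∑ j ∈ range i, Polynomial.C (ff n i (j + 1)) * auxP n (j + 1)
        + ∑ j ∈ range i, Polynomial.C ((xv n (j + 1) - xv n (i + 1) - tv n) * ff n i (j + 1))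
          * auxP n j := by
    rw [auxF, sum_mul, ← sum_add_distrib]
    refine sum_congr rfl fun j hj => ?_
    have : auxP n (j + 1) = auxP n j * (Polynomial.X - Polynomial.C (xv n (j + 1))) := by
      rw [auxP, prod_range_succ, ← auxP]
    rw [this]
    simp only [Polynomial.C_mul, Polynomial.C_sub]
    ring
  rw [h2, auxF, sum_range_succ, h1, hd, ← h0, Polynomial.C_add]
  ring

theorem auxF_closed (n i : ℕ) : Polynomial.C (tv n) * auxF n i =
    (Polynomial.X - ((i : Polynomial _) + 1) * Polynomial.C (tv n)) * auxP n i
      - (Polynomial.X - Polynomial.C (tv n)) *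
        (auxP n i).comp (Polynomial.X - Polynomial.C (tv n)) := by
  induction i with
  | zero => simp [auxF, auxP]
  | succ i ih =>
    have : auxP n (i + 1) = auxP n i * (Polynomial.X - Polynomial.C (xv n (i + 1))) := by
      rw [auxP, prod_range_succ, ← auxP]
    rw [auxF_succ, this, mul_add, ← mul_assoc, ih]
    simp only [Polynomial.mul_comp, Polynomial.sub_comp, Polynomial.X_comp, Polynomial.C_comp,
      Polynomial.C_sub, Polynomial.C_mul, map_add, map_one, map_natCast, Nat.cast_add, Nat.cast_one]
    ring

theorem auxQ_closed (n i : ℕ) :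
    (Polynomial.X - ((i : Polynomial _) + 1) * Polynomial.C (tv n)) * auxQ n i
      = (Polynomial.X - Polynomial.C (tv n)) *
        (auxQ n i).comp (Polynomial.X - Polynomial.C (tv n)) := by
  induction i with
  | zero => simp [auxQ]
  | succ i ih =>
    have : auxQ n (i + 1) = auxQ n i *
        (Polynomial.X - Polynomial.C (C ((i : ℚ) + 1) * tv n)) := by
      rw [auxQ, prod_range_succ, ← auxQ]
    rw [this]
    simp only [Polynomial.mul_comp, Polynomial.sub_comp, Polynomial.X_comp, Polynomial.C_comp,
      Polynomial.C_sub, Polynomial.C_mul, map_add, map_one, map_natCast, Nat.cast_add, Nat.cast_one]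
    simp only [Polynomial.add_comp, Polynomial.natCast_comp, Polynomial.one_comp]
    linear_combination (Polynomial.X - ((i : Polynomial (MvPolynomial (Option (Fin n)) ℚ)) + 1 + 1) * Polynomial.C (tv n)) * ih

theorem auxT_closed (n k : ℕ) : Polynomial.C (tv n) * auxT n k =
    (Polynomial.X - ((n : Polynomial _) + 1) * Polynomial.C (tv n)) * Polynomial.X ^ k
      - (Polynomial.X - Polynomial.C (tv n)) * (Polynomial.X - Polynomial.C (tv n)) ^ k := by
  have h := (Commute.all (Polynomial.X : Polynomial (MvPolynomial (Option (Fin n)) ℚ))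
    (Polynomial.X - Polynomial.C (tv n))).geom_sum₂_mul k
  have h2 : ∑ i ∈ range k, Polynomial.X ^ i * (Polynomial.X - Polynomial.C (tv n)) ^ (k - i)
      = (Polynomial.X - Polynomial.C (tv n)) * ∑ i ∈ range k,
        Polynomial.X ^ i * (Polynomial.X - Polynomial.C (tv n)) ^ (k - 1 - i) := by
    rw [mul_sum]
    refine sum_congr rfl fun i hi => ?_
    have := mem_range.1 hi
    rw [show k - i = (k - 1 - i) + 1 by omega, pow_succ]
    ring
  rw [auxT, h2]
  linear_combination (Polynomial.X - Polynomial.C (tv n)) * h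

theorem aux_monic_coeff {R : Type*} [CommRing R] [Nontrivial R] (p : Polynomial R) (k : ℕ)
    (hp : p.Monic) (hk : p.natDegree = k) : p.coeff k = 1 ∧ ∀ m, k < m → p.coeff m = 0 := by
  subst hk
  exact ⟨hp, fun m hm => Polynomial.coeff_eq_zero_of_natDegree_lt hm⟩

theorem auxP_coeff (n i : ℕ) : (auxP n i).coeff i = 1 ∧ ∀ m, i < m → (auxP n i).coeff m = 0 := by
  apply aux_monic_coeff
  · exact Polynomial.monic_prod_of_monic _ _ fun k _ => Polynomial.monic_X_sub_C _
  · rw [auxP, Polynomial.natDegree_prod_of_monic _ _ fun k _ => Polynomial.monic_X_sub_C _]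
    simp

theorem auxQ_coeff (n i : ℕ) : (auxQ n i).coeff i = 1 ∧ ∀ m, i < m → (auxQ n i).coeff m = 0 := by
  apply aux_monic_coeff
  · exact Polynomial.monic_prod_of_monic _ _ fun k _ => Polynomial.monic_X_sub_C _
  · rw [auxQ, Polynomial.natDegree_prod_of_monic _ _ fun k _ => Polynomial.monic_X_sub_C _]
    simp only [Polynomial.natDegree_X_sub_C]
    simp

theorem auxT_term (n k i : ℕ) (hi : i < k) :
    (Polynomial.X ^ i * (Polynomial.X - Polynomial.C (tv n)) ^ (k - i)).coeff k = 1 ∧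
    ∀ m, k < m →
      (Polynomial.X ^ i * (Polynomial.X - Polynomial.C (tv n)) ^ (k - i)).coeff m = 0 := by
  have h1 := Polynomial.monic_X_pow (R := MvPolynomial (Option (Fin n)) ℚ) i
  have h2 := (Polynomial.monic_X_sub_C (tv n)).pow (k - i)
  apply aux_monic_coeff _ _ (h1.mul h2)
  rw [h1.natDegree_mul h2, (Polynomial.monic_X_sub_C (tv n)).natDegree_pow]
  simp
  omega

theorem auxT_coeff (n k : ℕ) : (auxT n k).coeff k = C ((k : ℚ) - n) ∧
    ∀ m, k < m → (auxT n k).coeff m = 0 := by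
  constructor
  · rw [auxT, Polynomial.coeff_sub, Polynomial.finsetSum_coeff,
      sum_congr rfl fun i hi => (auxT_term n k i (mem_range.1 hi)).1, Polynomial.coeff_natCast_mul]
    simp
  · intro m hm
    rw [auxT, Polynomial.coeff_sub, Polynomial.finsetSum_coeff,
      sum_congr rfl fun i hi => (auxT_term n k i (mem_range.1 hi)).2 m hm,
      Polynomial.coeff_natCast_mul, Polynomial.coeff_X_pow, if_neg (by omega)]
    simp

theorem auxD_sum (n : ℕ) : auxP n n - auxQ n n = ∑ k ∈ range n,
    Polynomial.C ((auxP n n - auxQ n n).coeff k) * Polynomial.X ^ k := by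
  ext1 m
  rw [Polynomial.finsetSum_coeff]
  simp only [Polynomial.coeff_C_mul_X_pow]
  rw [Finset.sum_ite_eq]
  split_ifs with h
  · rfl
  · rw [mem_range, not_lt] at h
    rw [Polynomial.coeff_sub]
    rcases h.lt_or_eq with h | h
    · rw [(auxP_coeff n n).2 m h, (auxQ_coeff n n).2 m h, sub_zero]
    · subst h
      rw [(auxP_coeff n n).1, (auxQ_coeff n n).1, sub_self]

theorem auxF_T (n : ℕ) : auxF n n = ∑ k ∈ range n,
    Polynomial.C ((auxP n n - auxQ n n).coeff k) * auxT n k := by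
  have ht : Polynomial.C (tv n) ≠ 0 := by
    rw [Ne, Polynomial.C_eq_zero]
    exact X_ne_zero _
  apply mul_left_cancel₀ ht
  have h := auxD_sum n
  have hc : (auxP n n - auxQ n n).comp (Polynomial.X - Polynomial.C (tv n)) = ∑ k ∈ range n,
      Polynomial.C ((auxP n n - auxQ n n).coeff k) *
        (Polynomial.X - Polynomial.C (tv n)) ^ k := by
    conv_lhs => rw [h]
    rw [Polynomial.sum_comp]
    simp
  have hR : Polynomial.C (tv n) * ∑ k ∈ range n,
      Polynomial.C ((auxP n n - auxQ n n).coeff k) * auxT n k =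
      (Polynomial.X - ((n : Polynomial _) + 1) * Polynomial.C (tv n)) * (∑ k ∈ range n,
        Polynomial.C ((auxP n n - auxQ n n).coeff k) * Polynomial.X ^ k)
      - (Polynomial.X - Polynomial.C (tv n)) * ∑ k ∈ range n,
        Polynomial.C ((auxP n n - auxQ n n).coeff k) *
          (Polynomial.X - Polynomial.C (tv n)) ^ k := by
    rw [mul_sum, mul_sum, mul_sum, ← sum_sub_distrib]
    refine sum_congr rfl fun k _ => ?_
    linear_combination Polynomial.C ((auxP n n - auxQ n n).coeff k) * auxT_closed n k
  rw [hR, ← h, ← hc, auxF_closed, Polynomial.sub_comp]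
  linear_combination auxQ_closed n n

theorem auxD_coeff (n i : ℕ) (hi : i ≤ n) : (auxP n n - auxQ n n).coeff (n - i) =
    (-1) ^ i * (esymmX n i - C (esymmVal n i) * tv n ^ i) := by
  have hP : auxP n n = ∏ k : Fin n, (Polynomial.X + Polynomial.C (- X (some k))) := by
    rw [auxP, prod_range]
    refine prod_congr rfl fun k _ => ?_
    simp [xv, sub_eq_add_neg]
  have hQ : auxQ n n = ∏ k : Fin n, (Polynomial.X +
      Polynomial.C (- (C (((k : ℕ) : ℚ) + 1) * tv n))) := by
    rw [auxQ, prod_range]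
    refine prod_congr rfl fun k _ => ?_
    rw [Polynomial.C_neg, sub_eq_add_neg]
  rw [Polynomial.coeff_sub, hP, hQ, Finset.prod_X_add_C_coeff _ _ (by simp),
    Finset.prod_X_add_C_coeff _ _ (by simp)]
  have hc : #(univ : Finset (Fin n)) - (n - i) = i := by simp; omega
  rw [hc, mul_sub, esymmX, esymmVal, map_sum, sum_mul, mul_sum, mul_sum]
  congr 1
  · refine sum_congr rfl fun A hA => ?_
    rw [prod_neg, (mem_powersetCard.1 hA).2]
  · refine sum_congr rfl fun A hA => ?_
    rw [prod_neg, prod_mul_distrib, prod_const, (mem_powersetCard.1 hA).2, map_prod]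

theorem aux_iff (n : ℕ) (K : Ideal (MvPolynomial (Option (Fin n)) ℚ)) :
    (∀ j ∈ Set.Icc 1 n, ff n n j ∈ K) ↔
      ∀ i ∈ Set.Icc 1 n, esymmX n i - C (esymmVal n i) * tv n ^ i ∈ K := by
  have h1 := aux_tri K (fun j => ff n n (j + 1)) (auxP n) n
    (fun k _ => (auxP_coeff n k).2) (fun k _ => by rw [(auxP_coeff n k).1]; exact isUnit_one)
  have h2 := aux_tri K (fun k => (auxP n n - auxQ n n).coeff k) (auxT n) n
    (fun k _ => (auxT_coeff n k).2) (fun k hk => by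
      rw [(auxT_coeff n k).1]
      refine IsUnit.map C (IsUnit.mk0 _ ?_)
      rw [sub_ne_zero]
      exact_mod_cast hk.ne)
  rw [← auxF_T, auxF] at h2
  have h3 := h1.symm.trans h2
  have hu : ∀ i, IsUnit ((-1 : MvPolynomial (Option (Fin n)) ℚ) ^ i) :=
    fun i => (isUnit_one.neg).pow i
  constructor
  · rintro h i ⟨hi1, hi2⟩
    have := h3.1 (fun k hk => h (k + 1) ⟨by omega, by omega⟩) (n - i) (by omega)
    simp only [auxD_coeff n i hi2] at this
    exact (Ideal.unit_mul_mem_iff_mem K (hu i)).1 this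
  · rintro h j ⟨hj1, hj2⟩
    have := h3.2 (fun k hk => by
      have h4 := auxD_coeff n (n - k) (by omega)
      rw [show n - (n - k) = k by omega] at h4
      simp only [h4]
      exact Ideal.mul_mem_left _ _ (h (n - k) ⟨by omega, by omega⟩)) (j - 1) (by omega)
    simpa only [show j - 1 + 1 = j by omega] using this

/-- For the Hessenberg function `h = (n,n,…,n)`, the ideal `I(h)` generated by
`f_{n,1}, …, f_{n,n}` equals the ideal generated by
`e_i(x_1,…,x_n) - e_i(1,2,…,n)·t^i` for `1 ≤ i ≤ n`. -/
theorem stmt13 (n : ℕ) (hn : 1 ≤ n) :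
    Ideal.span ((fun j => ff n n j) '' Set.Icc 1 n) =
      Ideal.span ((fun i => esymmX n i - C (esymmVal n i) * tv n ^ i) '' Set.Icc 1 n) := by
  apply le_antisymm
  · rw [Ideal.span_le, Set.image_subset_iff]
    exact (aux_iff n _).2 fun i hi => Ideal.subset_span ⟨i, hi, rfl⟩
  · rw [Ideal.span_le, Set.image_subset_iff]
    exact (aux_iff n _).1 fun i hi => Ideal.subset_span ⟨i, hi, rfl⟩
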